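/- Let (M,·,ρ,μ) be both a left H-Hom-module and a right H-Hom-comodule. Then the compatibility condition ρ(h·m) = α(h₂₁)·m₍₀₎ ⊗ (B(h₂₂)α⁻¹(m₍₁₎))·A(S⁻¹(h₁)) holds for all h,m if and only if h₁·m₍₀₎ ⊗ B(h₂)m₍₁₎ = μ((h₂·μ⁻¹(m))₍₀₎) ⊗ (h₂·μ⁻¹(m))₍₁₎·A(h₁) holds for all h,m. -/

import Mathlib

open TensorProduct

/-- A monoidal Hom-Hopf algebra (with bijective antipode) over a field `k`. -/
structure HomHopf (k : Type*) [Field k] (H : Type*) [AddCommGroup H] [Module k H] where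
  mul : H →ₗ[k] H →ₗ[k] H
  one : H
  a : H ≃ₗ[k] H
  comul : H →ₗ[k] H ⊗[k] H
  counit : H →ₗ[k] k
  S : H ≃ₗ[k] H
  hom_assoc : ∀ x y z : H, mul (a x) (mul y z) = mul (mul x y) (a z)
  a_mul : ∀ x y : H, a (mul x y) = mul (a x) (a y)
  mul_one' : ∀ x : H, mul x one = a x
  one_mul' : ∀ x : H, mul one x = a x
  a_one : a one = one
  hom_coassoc : (TensorProduct.map a.symm.toLinearMap comul).comp comul
      = (TensorProduct.assoc k H H H).toLinearMap.comp
          ((TensorProduct.map comul a.symm.toLinearMap).comp comul)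
  comul_a : ∀ x : H, comul (a x) = TensorProduct.map a.toLinearMap a.toLinearMap (comul x)
  counit_comul : ∀ x : H,
    (TensorProduct.lid k H) ((TensorProduct.map counit LinearMap.id) (comul x)) = a.symm x
  comul_counit : ∀ x : H,
    (TensorProduct.rid k H) ((TensorProduct.map LinearMap.id counit) (comul x)) = a.symm x
  counit_a : ∀ x : H, counit (a x) = counit x
  comul_mul : ∀ x y : H, comul (mul x y)
      = (TensorProduct.map (TensorProduct.lift mul) (TensorProduct.lift mul))
          ((TensorProduct.tensorTensorTensorComm k H H H H) (comul x ⊗ₜ[k] comul y))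
  comul_one : comul one = one ⊗ₜ[k] one
  counit_mul : ∀ x y : H, counit (mul x y) = counit x * counit y
  counit_one : counit one = 1
  S_a : ∀ x : H, S (a x) = a (S x)
  antipode_left : ∀ x : H,
    (TensorProduct.lift mul) ((TensorProduct.map S.toLinearMap LinearMap.id) (comul x))
      = counit x • one
  antipode_right : ∀ x : H,
    (TensorProduct.lift mul) ((TensorProduct.map LinearMap.id S.toLinearMap) (comul x))
      = counit x • one

/-- A monoidal Hom-Hopf algebra automorphism. -/
structure IsHomHopfAuto {k : Type*} [Field k] {H : Type*} [AddCommGroup H] [Module k H]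
    (HH : HomHopf k H) (f : H ≃ₗ[k] H) : Prop where
  map_mul : ∀ x y : H, f (HH.mul x y) = HH.mul (f x) (f y)
  map_one : f HH.one = HH.one
  map_comul : ∀ x : H, HH.comul (f x)
      = TensorProduct.map f.toLinearMap f.toLinearMap (HH.comul x)
  map_counit : ∀ x : H, HH.counit (f x) = HH.counit x
  map_a : ∀ x : H, f (HH.a x) = HH.a (f x)

/-- A left-right (A,B)-Yetter-Drinfeld Hom-module over `HH`. -/
structure YDModule {k : Type*} [Field k] {H : Type*} [AddCommGroup H] [Module k H]
    (HH : HomHopf k H) (A B : H ≃ₗ[k] H)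
    (M : Type*) [AddCommGroup M] [Module k M] where
  act : H →ₗ[k] M →ₗ[k] M
  coact : M →ₗ[k] M ⊗[k] H
  mu : M ≃ₗ[k] M
  hom_act : ∀ (h g : H) (m : M), act (HH.a h) (act g m) = act (HH.mul h g) (mu m)
  mu_act : ∀ (h : H) (m : M), mu (act h m) = act (HH.a h) (mu m)
  one_act : ∀ m : M, act HH.one m = mu m
  hom_coact : (TensorProduct.map mu.symm.toLinearMap HH.comul).comp coact
      = (TensorProduct.assoc k M H H).toLinearMap.comp
          ((TensorProduct.map coact HH.a.symm.toLinearMap).comp coact)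
  coact_mu : ∀ m : M, coact (mu m)
      = TensorProduct.map mu.toLinearMap HH.a.toLinearMap (coact m)
  coact_counit : ∀ m : M,
    (TensorProduct.rid k M) ((TensorProduct.map LinearMap.id HH.counit) (coact m)) = mu.symm m
  compat : ∀ (h : H) (m : M) (n : ℕ) (h1 h2 : Fin n → H),
      HH.comul h = ∑ i, h1 i ⊗ₜ[k] h2 i →
      ∀ (p : ℕ) (h21 h22 : Fin n → Fin p → H),
      (∀ i, HH.comul (h2 i) = ∑ j, h21 i j ⊗ₜ[k] h22 i j) →
      ∀ (q : ℕ) (m0 : Fin q → M) (m1 : Fin q → H),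
      coact m = ∑ l, m0 l ⊗ₜ[k] m1 l →
      coact (act h m) = ∑ i, ∑ j, ∑ l,
        act (HH.a (h21 i j)) (m0 l) ⊗ₜ[k]
          HH.mul (HH.mul (B (h22 i j)) (HH.a.symm (m1 l))) (A (HH.S.symm (h1 i)))

namespace HomHopf

section Untwist

variable {k : Type*} [Field k] {H : Type*} [AddCommGroup H] [Module k H] (HH : HomHopf k H)

theorem symm_mul (x y : H) : HH.a.symm (HH.mul x y) = HH.mul (HH.a.symm x) (HH.a.symm y) := by
  rw [LinearEquiv.symm_apply_eq, HH.a_mul]; simp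

theorem symm_one : HH.a.symm HH.one = HH.one := by
  rw [LinearEquiv.symm_apply_eq, HH.a_one]

/-- The untwisted comultiplication `(α ⊗ α) ∘ Δ`. -/
noncomputable def comul' : H →ₗ[k] H ⊗[k] H :=
  (TensorProduct.map HH.a.toLinearMap HH.a.toLinearMap).comp HH.comul

theorem comul'_apply (x : H) :
    HH.comul' x = TensorProduct.map HH.a.toLinearMap HH.a.toLinearMap (HH.comul x) := rfl

theorem comul'_eq (x : H) : HH.comul' x = HH.comul (HH.a x) := (HH.comul_a x).symm

theorem rTensor_counit_comul' (x : H) : HH.counit.rTensor H (HH.comul' x) = 1 ⊗ₜ[k] x := by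
  apply (TensorProduct.lid k H).injective
  rw [comul'_eq]
  exact (HH.counit_comul (HH.a x)).trans (by simp)

theorem lTensor_counit_comul' (x : H) : HH.counit.lTensor H (HH.comul' x) = x ⊗ₜ[k] 1 := by
  apply (TensorProduct.rid k H).injective
  rw [comul'_eq]
  exact (HH.comul_counit (HH.a x)).trans (by simp)

theorem coassoc' (x : H) :
    TensorProduct.assoc k H H H (HH.comul'.rTensor H (HH.comul' x))
      = HH.comul'.lTensor H (HH.comul' x) := by
  have h := LinearMap.congr_fun HH.hom_coassoc (HH.a (HH.a x))
  have hl : ∀ t : H ⊗[k] H,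
      TensorProduct.map HH.a.symm.toLinearMap HH.comul
        (TensorProduct.map HH.a.toLinearMap HH.a.toLinearMap t)
        = HH.comul'.lTensor H t := by
    intro t
    induction t with
    | zero => simp
    | tmul y z => simp [comul'_eq]
    | add s t hs ht => simp only [map_add, hs, ht]
  have hr : ∀ t : H ⊗[k] H,
      TensorProduct.map HH.comul HH.a.symm.toLinearMap
        (TensorProduct.map HH.a.toLinearMap HH.a.toLinearMap t)
        = HH.comul'.rTensor H t := by
    intro t
    induction t with
    | zero => simp
    | tmul y z => simp [comul'_eq]
    | add s t hs ht => simp only [map_add, hs, ht]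
  simp only [LinearMap.comp_apply, HH.comul_a (HH.a x), hl, hr, LinearEquiv.coe_coe] at h
  rw [comul'_eq]
  exact h.symm

/-- The ring obtained from a monoidal Hom-Hopf algebra by untwisting the multiplication. -/
abbrev ring : Ring H where
  __ := (inferInstance : AddCommGroup H)
  mul x y := HH.a.symm (HH.mul x y)
  one := HH.one
  left_distrib x y z := by
    change HH.a.symm (HH.mul x (y + z)) = HH.a.symm (HH.mul x y) + HH.a.symm (HH.mul x z)
    simp
  right_distrib x y z := by
    change HH.a.symm (HH.mul (x + y) z) = HH.a.symm (HH.mul x z) + HH.a.symm (HH.mul y z)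
    simp
  zero_mul x := by
    change HH.a.symm (HH.mul 0 x) = 0
    simp
  mul_zero x := by
    change HH.a.symm (HH.mul x 0) = 0
    simp
  mul_assoc x y z := by
    change HH.a.symm (HH.mul (HH.a.symm (HH.mul x y)) z)
      = HH.a.symm (HH.mul x (HH.a.symm (HH.mul y z)))
    have h := HH.hom_assoc (HH.a.symm x) (HH.a.symm y) (HH.a.symm z)
    simp only [LinearEquiv.apply_symm_apply] at h
    rw [HH.symm_mul x y, HH.symm_mul y z, h]
  one_mul x := by
    change HH.a.symm (HH.mul HH.one x) = x
    simp [HH.one_mul']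
  mul_one x := by
    change HH.a.symm (HH.mul x HH.one) = x
    simp [HH.mul_one']

theorem ring_mul_def (x y : H) :
    letI := HH.ring
    x * y = HH.a.symm (HH.mul x y) := rfl

/-- The algebra structure on the untwisted ring. -/
noncomputable abbrev algebra : letI := HH.ring; Algebra k H :=
  letI := HH.ring
  Algebra.ofModule
    (fun r x y => by simp [HH.ring_mul_def])
    (fun r x y => by simp [HH.ring_mul_def])

/-- The untwisted coalgebra. -/
noncomputable abbrev coalgebra : Coalgebra k H where
  comul := HH.comul'
  counit := HH.counit
  coassoc := LinearMap.ext HH.coassoc'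
  rTensor_counit_comp_comul := LinearMap.ext HH.rTensor_counit_comul'
  lTensor_counit_comp_comul := LinearMap.ext HH.lTensor_counit_comul'

theorem comul'_mul (x y : H) :
    letI := HH.ring
    letI := HH.algebra
    HH.comul' (x * y) = HH.comul' x * HH.comul' y := by
  let _ := HH.ring
  let _ := HH.algebra
  have h : ∀ s t : H ⊗[k] H,
      TensorProduct.map (TensorProduct.lift HH.mul) (TensorProduct.lift HH.mul)
        (TensorProduct.tensorTensorTensorComm k H H H H (s ⊗ₜ[k] t))
      = TensorProduct.map HH.a.toLinearMap HH.a.toLinearMap s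
        * TensorProduct.map HH.a.toLinearMap HH.a.toLinearMap t := by
    intro s t
    induction s with
    | zero => simp
    | add s s' hs hs' => simp only [map_add, TensorProduct.add_tmul, add_mul, hs, hs']
    | tmul p q =>
      induction t with
      | zero => simp
      | add s s' hs hs' => simp only [map_add, TensorProduct.tmul_add, mul_add, hs, hs']
      | tmul r s => simp [HH.ring_mul_def, HH.symm_mul]
  rw [comul'_eq, HH.ring_mul_def, LinearEquiv.apply_symm_apply, HH.comul_mul, h]
  rfl

/-- The untwisted Hopf algebra. -/
noncomputable abbrev hopfAlgebra : letI := HH.ring; HopfAlgebra k H :=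
  letI := HH.ring
  letI := HH.algebra
  letI := HH.coalgebra
  letI : Bialgebra k H := Bialgebra.mk' k H HH.counit_one
    (fun {x y} => by
      change HH.counit (HH.a.symm (HH.mul x y)) = HH.counit x * HH.counit y
      rw [← HH.counit_a, LinearEquiv.apply_symm_apply, HH.counit_mul])
    (by
      change HH.comul' HH.one = HH.one ⊗ₜ[k] HH.one
      rw [comul'_eq, HH.a_one, HH.comul_one])
    (fun {x y} => HH.comul'_mul x y)
  { antipode := HH.S.toLinearMap
    mul_antipode_rTensor_comul := by
      ext x
      have h : ∀ t : H ⊗[k] H, LinearMap.mul' k H (HH.S.toLinearMap.rTensor H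
          (TensorProduct.map HH.a.toLinearMap HH.a.toLinearMap t))
          = TensorProduct.lift HH.mul (TensorProduct.map HH.S.toLinearMap LinearMap.id t) := by
        intro t
        induction t with
        | zero => simp
        | tmul y z => simp [HH.ring_mul_def, HH.symm_mul, HH.S_a]
        | add s t hs ht => simp only [map_add, hs, ht]
      exact (h (HH.comul x)).trans
        ((HH.antipode_left x).trans (Algebra.algebraMap_eq_smul_one _).symm)
    mul_antipode_lTensor_comul := by
      ext x
      have h : ∀ t : H ⊗[k] H, LinearMap.mul' k H (HH.S.toLinearMap.lTensor H
          (TensorProduct.map HH.a.toLinearMap HH.a.toLinearMap t))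
          = TensorProduct.lift HH.mul (TensorProduct.map LinearMap.id HH.S.toLinearMap t) := by
        intro t
        induction t with
        | zero => simp
        | tmul y z => simp [HH.ring_mul_def, HH.symm_mul, HH.S_a]
        | add s t hs ht => simp only [map_add, hs, ht]
      exact (h (HH.comul x)).trans
        ((HH.antipode_right x).trans (Algebra.algebraMap_eq_smul_one _).symm) }

theorem S_symm_a (x : H) : HH.S.symm (HH.a x) = HH.a (HH.S.symm x) := by
  rw [LinearEquiv.symm_apply_eq, HH.S_a, LinearEquiv.apply_symm_apply]

theorem S_mul (x y : H) : HH.S (HH.mul x y) = HH.mul (HH.S y) (HH.S x) := by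
  let _ := HH.ring
  let _ := HH.hopfAlgebra
  have h : HH.S (HH.a.symm (HH.mul x y)) = HH.a.symm (HH.mul (HH.S y) (HH.S x)) :=
    HopfAlgebra.antipode_mul_antidistrib (R := k) x y
  rw [LinearEquiv.eq_symm_apply, ← HH.S_a, LinearEquiv.apply_symm_apply] at h
  exact h

theorem S_one : HH.S HH.one = HH.one := by
  let _ := HH.ring
  let _ := HH.hopfAlgebra
  exact HopfAlgebra.antipode_one (R := k) (A := H)

theorem S_symm_mul (x y : H) :
    HH.S.symm (HH.mul x y) = HH.mul (HH.S.symm y) (HH.S.symm x) := by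
  rw [LinearEquiv.symm_apply_eq, HH.S_mul]
  simp

theorem S_symm_one : HH.S.symm HH.one = HH.one := by
  rw [LinearEquiv.symm_apply_eq, HH.S_one]

/-- The untwisted multiplication `α⁻¹ ∘ m`. -/
noncomputable def mul' : H →ₗ[k] H →ₗ[k] H := HH.mul.compr₂ HH.a.symm.toLinearMap

@[simp]
theorem mul'_apply (x y : H) : HH.mul' x y = HH.a.symm (HH.mul x y) := rfl

end Untwist

section Convolution

variable {k : Type*} [Field k] {H : Type*} [AddCommGroup H] [Module k H] (HH : HomHopf k H)
  {E : Type*} [AddCommGroup E] [Module k E]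

/-- The convolution `h ↦ f(h₂) · u(h₁)` with respect to the untwisted comultiplication and a
right action `R` of `H` on `E`. -/
noncomputable def conv (R : H →ₗ[k] E →ₗ[k] E) (u : H →ₗ[k] H) (f : H →ₗ[k] E) : H →ₗ[k] E :=
  (TensorProduct.lift ((R ∘ₗ u).compl₂ f)).comp HH.comul'

theorem conv_conv (R : H →ₗ[k] E →ₗ[k] E) (u v : H →ₗ[k] H) (f : H →ₗ[k] E)
    (hR : ∀ x y e, R x (R y e) = R (HH.mul' y x) e) (hR_one : ∀ e, R HH.one e = e)
    (huv : ∀ h, TensorProduct.lift (HH.mul'.flip.compl₁₂ u v) (HH.comul' h)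
      = HH.counit h • HH.one) :
    HH.conv R u (HH.conv R v f) = f := by
  ext h
  set T : H ⊗[k] (H ⊗[k] H) →ₗ[k] E :=
    TensorProduct.lift ((R ∘ₗ u).compl₂ (TensorProduct.lift ((R ∘ₗ v).compl₂ f))) with hT
  have h1 : ∀ t : H ⊗[k] H, TensorProduct.lift ((R ∘ₗ u).compl₂ (HH.conv R v f)) t
      = T (HH.comul'.lTensor H t) := by
    intro t
    induction t with
    | zero => simp
    | tmul y z => simp [hT, conv]
    | add s t hs ht => simp only [map_add, hs, ht]
  have h2 : ∀ (s : H ⊗[k] H) (z : H), T (TensorProduct.assoc k H H H (s ⊗ₜ z))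
      = R (TensorProduct.lift (HH.mul'.flip.compl₁₂ u v) s) (f z) := by
    intro s z
    induction s with
    | zero => simp
    | tmul x y => simp [hT, hR]
    | add s t hs ht => simp only [map_add, TensorProduct.add_tmul, hs, ht, LinearMap.add_apply]
  have h3 : ∀ t : H ⊗[k] H, T (TensorProduct.assoc k H H H (HH.comul'.rTensor H t))
      = TensorProduct.lid k E (TensorProduct.map LinearMap.id f (HH.counit.rTensor H t)) := by
    intro t
    induction t with
    | zero => simp
    | tmul y z => simp [h2, huv, hR_one]
    | add s t hs ht => simp only [map_add, hs, ht]
  change TensorProduct.lift ((R ∘ₗ u).compl₂ (HH.conv R v f)) (HH.comul' h) = f h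
  rw [h1, ← HH.coassoc', h3, HH.rTensor_counit_comul']
  simp

variable {A : H ≃ₗ[k] H}

theorem lift_mul'_S_symm_left (hA : IsHomHopfAuto HH A) (h : H) :
    TensorProduct.lift (HH.mul'.flip.compl₁₂ A.toLinearMap (A.toLinearMap ∘ₗ HH.S.symm.toLinearMap))
      (HH.comul' h) = HH.counit h • HH.one := by
  have key : ∀ t : H ⊗[k] H, TensorProduct.lift
      (HH.mul'.flip.compl₁₂ A.toLinearMap (A.toLinearMap ∘ₗ HH.S.symm.toLinearMap))
      (TensorProduct.map HH.a.toLinearMap HH.a.toLinearMap t)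
      = A (HH.S.symm (TensorProduct.lift HH.mul
          (TensorProduct.map HH.S.toLinearMap LinearMap.id t))) := by
    intro t
    induction t with
    | zero => simp
    | tmul y z => simp [HH.S_symm_a, hA.map_a, HH.symm_mul, HH.S_symm_mul, hA.map_mul]
    | add s t hs ht => simp only [map_add, hs, ht]
  rw [comul'_apply, key, HH.antipode_left]
  simp [HH.S_symm_one, hA.map_one]

theorem lift_mul'_S_symm_right (hA : IsHomHopfAuto HH A) (h : H) :
    TensorProduct.lift (HH.mul'.flip.compl₁₂ (A.toLinearMap ∘ₗ HH.S.symm.toLinearMap) A.toLinearMap)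
      (HH.comul' h) = HH.counit h • HH.one := by
  have key : ∀ t : H ⊗[k] H, TensorProduct.lift
      (HH.mul'.flip.compl₁₂ (A.toLinearMap ∘ₗ HH.S.symm.toLinearMap) A.toLinearMap)
      (TensorProduct.map HH.a.toLinearMap HH.a.toLinearMap t)
      = A (HH.S.symm (TensorProduct.lift HH.mul
          (TensorProduct.map LinearMap.id HH.S.toLinearMap t))) := by
    intro t
    induction t with
    | zero => simp
    | tmul y z => simp [HH.S_symm_a, hA.map_a, HH.symm_mul, HH.S_symm_mul, hA.map_mul]
    | add s t hs ht => simp only [map_add, hs, ht]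
  rw [comul'_apply, key, HH.antipode_right]
  simp [HH.S_symm_one, hA.map_one]

/-- Convolution by `A` and by `A ∘ S⁻¹` are mutually inverse. -/
theorem eq_conv_comp_S_symm_iff (hA : IsHomHopfAuto HH A) (R : H →ₗ[k] E →ₗ[k] E) (f g : H →ₗ[k] E)
    (hR : ∀ x y e, R x (R y e) = R (HH.mul' y x) e) (hR_one : ∀ e, R HH.one e = e) :
    f = HH.conv R (A.toLinearMap ∘ₗ HH.S.symm.toLinearMap) g ↔ g = HH.conv R A.toLinearMap f := by
  constructor
  · rintro rfl
    exact (HH.conv_conv R _ _ g hR hR_one (HH.lift_mul'_S_symm_left hA)).symm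
  · rintro rfl
    exact (HH.conv_conv R _ _ f hR hR_one (HH.lift_mul'_S_symm_right hA)).symm

end Convolution

section RightMul

variable {k : Type*} [Field k] {H : Type*} [AddCommGroup H] [Module k H] (HH : HomHopf k H)
  (M : Type*) [AddCommGroup M] [Module k M]

/-- Untwisted right multiplication of `H` on the second factor of `M ⊗ H`. -/
noncomputable def rightMul : H →ₗ[k] M ⊗[k] H →ₗ[k] M ⊗[k] H :=
  (LinearMap.lTensorHom M).comp HH.mul'.flip

@[simp]
theorem rightMul_tmul (x : H) (m : M) (y : H) :
    HH.rightMul M x (m ⊗ₜ y) = m ⊗ₜ HH.a.symm (HH.mul y x) := rfl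

theorem rightMul_rightMul (x y : H) (e : M ⊗[k] H) :
    HH.rightMul M x (HH.rightMul M y e) = HH.rightMul M (HH.mul' y x) e := by
  induction e with
  | zero => simp
  | add s t hs ht => simp only [map_add, hs, ht]
  | tmul m z =>
    have h := HH.hom_assoc (HH.a.symm z) (HH.a.symm y) (HH.a.symm x)
    simp only [LinearEquiv.apply_symm_apply] at h
    simp only [rightMul_tmul, mul'_apply]
    rw [HH.symm_mul z y, HH.symm_mul y x, h]

theorem rightMul_one (e : M ⊗[k] H) : HH.rightMul M HH.one e = e := by
  induction e with
  | zero => simp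
  | add s t hs ht => simp only [map_add, hs, ht]
  | tmul m z => simp [HH.mul_one']

end RightMul

section Braiding

variable {k : Type*} [Field k] {H : Type*} [AddCommGroup H] [Module k H] (HH : HomHopf k H)
  {M : Type*} [AddCommGroup M] [Module k M]

/-- The map `h ↦ h₁ · m₍₀₎ ⊗ B(h₂) m₍₁₎`, where `c = m₍₀₎ ⊗ m₍₁₎`. -/
noncomputable def diagAct (B : H ≃ₗ[k] H) (act : H →ₗ[k] M →ₗ[k] M) (c : M ⊗[k] H) :
    H →ₗ[k] M ⊗[k] H :=
  ((TensorProduct.map₂ act (HH.mul ∘ₗ B.toLinearMap)).flip c).comp HH.comul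

theorem diagAct_eq_sum (B : H ≃ₗ[k] H) (act : H →ₗ[k] M →ₗ[k] M) {ι κ : Type*} [Fintype ι]
    [Fintype κ] {h : H} {h1 h2 : ι → H} (hh : HH.comul h = ∑ i, h1 i ⊗ₜ[k] h2 i)
    (m0 : κ → M) (m1 : κ → H) :
    HH.diagAct B act (∑ l, m0 l ⊗ₜ[k] m1 l) h
      = ∑ i, ∑ l, act (h1 i) (m0 l) ⊗ₜ[k] HH.mul (B (h2 i)) (m1 l) := by
  rw [Finset.sum_comm]
  simp [diagAct, hh]

theorem conv_eq_sum {E : Type*} [AddCommGroup E] [Module k E] (R : H →ₗ[k] E →ₗ[k] E)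
    (u : H →ₗ[k] H) (f : H →ₗ[k] E) {ι : Type*} [Fintype ι]
    {h : H} {h1 h2 : ι → H} (hh : HH.comul h = ∑ i, h1 i ⊗ₜ[k] h2 i) :
    HH.conv R u f h = ∑ i, R (u (HH.a (h1 i))) (f (HH.a (h2 i))) := by
  simp [conv, comul'_apply, hh]

variable {A B : H ≃ₗ[k] H}

theorem conv_diagAct_eq_sum (hA : IsHomHopfAuto HH A) (hB : IsHomHopfAuto HH B)
    (act : H →ₗ[k] M →ₗ[k] M) {ι κ τ : Type*}
    [Fintype ι] [Fintype κ] [Fintype τ] {h : H} {h1 h2 : ι → H}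
    (hh : HH.comul h = ∑ i, h1 i ⊗ₜ[k] h2 i) {h21 h22 : ι → τ → H}
    (hh2 : ∀ i, HH.comul (h2 i) = ∑ j, h21 i j ⊗ₜ[k] h22 i j)
    (m0 : κ → M) (m1 : κ → H) :
    HH.conv (HH.rightMul M) (A.toLinearMap ∘ₗ HH.S.symm.toLinearMap)
        (HH.diagAct B act (∑ l, m0 l ⊗ₜ[k] m1 l)) h
      = ∑ i, ∑ j, ∑ l, act (HH.a (h21 i j)) (m0 l) ⊗ₜ[k]
          HH.mul (HH.mul (B (h22 i j)) (HH.a.symm (m1 l))) (A (HH.S.symm (h1 i))) := by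
  rw [HH.conv_eq_sum _ _ _ hh]
  refine Finset.sum_congr rfl fun i _ => ?_
  have h2a : HH.comul (HH.a (h2 i)) = ∑ j, HH.a (h21 i j) ⊗ₜ[k] HH.a (h22 i j) := by
    simp [HH.comul_a, hh2]
  rw [HH.diagAct_eq_sum B act h2a]
  simp [HH.symm_mul, HH.S_symm_a, hA.map_a, hB.map_a]

theorem conv_coact_eq_sum (hA : IsHomHopfAuto HH A) (act : H →ₗ[k] M →ₗ[k] M)
    (coact : M →ₗ[k] M ⊗[k] H) (mu : M ≃ₗ[k] M)
    (mu_act : ∀ (h : H) (m : M), mu (act h m) = act (HH.a h) (mu m))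
    (coact_mu : ∀ m : M, coact (mu m)
      = TensorProduct.map mu.toLinearMap HH.a.toLinearMap (coact m)) {ι κ : Type*}
    [Fintype ι] [Fintype κ] {h : H} {h1 h2 : ι → H}
    (hh : HH.comul h = ∑ i, h1 i ⊗ₜ[k] h2 i) (m : M) {w0 : ι → κ → M} {w1 : ι → κ → H}
    (hw : ∀ i, coact (act (h2 i) (mu.symm m)) = ∑ j, w0 i j ⊗ₜ[k] w1 i j) :
    HH.conv (HH.rightMul M) A.toLinearMap (coact ∘ₗ act.flip m) h
      = ∑ i, ∑ j, mu (w0 i j) ⊗ₜ[k] HH.mul (w1 i j) (A (h1 i)) := by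
  rw [HH.conv_eq_sum _ _ _ hh]
  refine Finset.sum_congr rfl fun i _ => ?_
  have h2a : act (HH.a (h2 i)) m = mu (act (h2 i) (mu.symm m)) := by simp [mu_act]
  simp [h2a, coact_mu, hw, hA.map_a, HH.symm_mul]

end Braiding

end HomHopf

/-- Finitely many tensors can be written as sums of pure tensors with a common number of terms. -/
theorem TensorProduct.exists_fin_sum_tmul {k : Type*} [CommSemiring k] {M N : Type*}
    [AddCommMonoid M] [AddCommMonoid N] [Module k M] [Module k N] {ι : Type*} [Fintype ι]
    (t : ι → M ⊗[k] N) :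
    ∃ (p : ℕ) (x : ι → Fin p → M) (y : ι → Fin p → N), ∀ i, t i = ∑ j, x i j ⊗ₜ[k] y i j := by
  classical
  choose s hs using fun i => TensorProduct.exists_finset (t i)
  let U := Finset.univ.biUnion s
  refine ⟨U.card, fun i j => if (U.equivFin.symm j : M × N) ∈ s i then
    (U.equivFin.symm j : M × N).1 else 0, fun i j => (U.equivFin.symm j : M × N).2, fun i => ?_⟩
  rw [U.equivFin.symm.sum_comp
    (fun z : U => (if (z : M × N) ∈ s i then (z : M × N).1 else 0) ⊗ₜ[k] (z : M × N).2),
    Finset.sum_coe_sort U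
      (fun z : M × N => (if z ∈ s i then z.1 else 0) ⊗ₜ[k] z.2), hs i]
  have hU : s i ⊆ U := Finset.subset_biUnion_of_mem s (Finset.mem_univ i)
  rw [← Finset.sum_subset hU fun z _ hz => by simp [hz]]
  exact Finset.sum_congr rfl fun z hz => by simp [hz]

/-- Proposition 2.3: for (M,·,ρ,μ) a left H-Hom-module and right H-Hom-comodule,
the (A,B)-Yetter-Drinfeld compatibility (2.1) holds iff condition (2.2) holds. -/
theorem stmt_4 {k : Type*} [Field k] {H : Type*} [AddCommGroup H] [Module k H]
    {M : Type*} [AddCommGroup M] [Module k M]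
    (HH : HomHopf k H) (A B : H ≃ₗ[k] H)
    (hA : IsHomHopfAuto HH A) (hB : IsHomHopfAuto HH B)
    (act : H →ₗ[k] M →ₗ[k] M) (coact : M →ₗ[k] M ⊗[k] H) (mu : M ≃ₗ[k] M)
    (hom_act : ∀ (h g : H) (m : M), act (HH.a h) (act g m) = act (HH.mul h g) (mu m))
    (mu_act : ∀ (h : H) (m : M), mu (act h m) = act (HH.a h) (mu m))
    (one_act : ∀ m : M, act HH.one m = mu m)
    (hom_coact : (TensorProduct.map mu.symm.toLinearMap HH.comul).comp coact
      = (TensorProduct.assoc k M H H).toLinearMap.comp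
          ((TensorProduct.map coact HH.a.symm.toLinearMap).comp coact))
    (coact_mu : ∀ m : M, coact (mu m)
      = TensorProduct.map mu.toLinearMap HH.a.toLinearMap (coact m))
    (coact_counit : ∀ m : M,
      (TensorProduct.rid k M) ((TensorProduct.map LinearMap.id HH.counit) (coact m)) = mu.symm m) :
    ( -- (2.1): ρ(h·m) = α(h₂₁)·m₍₀₎ ⊗ (B(h₂₂)α⁻¹(m₍₁₎))A(S⁻¹(h₁))
      ∀ (h : H) (m : M) (n : ℕ) (h1 h2 : Fin n → H),
        HH.comul h = ∑ i, h1 i ⊗ₜ[k] h2 i →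
        ∀ (p : ℕ) (h21 h22 : Fin n → Fin p → H),
        (∀ i, HH.comul (h2 i) = ∑ j, h21 i j ⊗ₜ[k] h22 i j) →
        ∀ (q : ℕ) (m0 : Fin q → M) (m1 : Fin q → H),
        coact m = ∑ l, m0 l ⊗ₜ[k] m1 l →
        coact (act h m) = ∑ i, ∑ j, ∑ l,
          act (HH.a (h21 i j)) (m0 l) ⊗ₜ[k]
            HH.mul (HH.mul (B (h22 i j)) (HH.a.symm (m1 l))) (A (HH.S.symm (h1 i))) )
    ↔
    ( -- (2.2): h₁·m₍₀₎ ⊗ B(h₂)m₍₁₎ = μ((h₂·μ⁻¹(m))₍₀₎) ⊗ (h₂·μ⁻¹(m))₍₁₎ A(h₁)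
      ∀ (h : H) (m : M) (n : ℕ) (h1 h2 : Fin n → H),
        HH.comul h = ∑ i, h1 i ⊗ₜ[k] h2 i →
        ∀ (q : ℕ) (m0 : Fin q → M) (m1 : Fin q → H),
        coact m = ∑ l, m0 l ⊗ₜ[k] m1 l →
        ∀ (r : ℕ) (w0 : Fin n → Fin r → M) (w1 : Fin n → Fin r → H),
        (∀ i, coact (act (h2 i) (mu.symm m)) = ∑ j, w0 i j ⊗ₜ[k] w1 i j) →
        (∑ i, ∑ l, act (h1 i) (m0 l) ⊗ₜ[k] HH.mul (B (h2 i)) (m1 l))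
          = ∑ i, ∑ j, mu (w0 i j) ⊗ₜ[k] HH.mul (w1 i j) (A (h1 i)) ) := by
  have key (m : M) := HH.eq_conv_comp_S_symm_iff hA (HH.rightMul M) (coact ∘ₗ act.flip m)
    (HH.diagAct B act (coact m)) (HH.rightMul_rightMul M) (HH.rightMul_one M)
  constructor
  · intro H1 h m n h1 h2 hh q m0 m1 hm r w0 w1 hw
    rw [← HH.conv_coact_eq_sum hA act coact mu mu_act coact_mu hh m hw,
      ← HH.diagAct_eq_sum B act hh, ← hm, ← (key m).mp]
    ext g
    obtain ⟨n, g1, g2, hg⟩ := TensorProduct.exists_fin_sum_tmul fun _ : Unit => HH.comul g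
    obtain ⟨p, g21, g22, hg2⟩ := TensorProduct.exists_fin_sum_tmul fun i => HH.comul (g2 () i)
    rw [hm, HH.conv_diagAct_eq_sum hA hB act (hg ()) hg2]
    exact H1 g m n _ _ (hg ()) p _ _ hg2 q m0 m1 hm
  · intro H2 h m n h1 h2 hh p h21 h22 hh2 q m0 m1 hm
    rw [← HH.conv_diagAct_eq_sum hA hB act hh hh2, ← hm, ← (key m).mpr]
    · rfl
    ext g
    obtain ⟨n, g1, g2, hg⟩ := TensorProduct.exists_fin_sum_tmul fun _ : Unit => HH.comul g
    obtain ⟨r, w0, w1, hw⟩ := TensorProduct.exists_fin_sum_tmul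
      fun i => coact (act (g2 () i) (mu.symm m))
    rw [HH.conv_coact_eq_sum hA act coact mu mu_act coact_mu (hg ()) m hw, hm,
      HH.diagAct_eq_sum B act (hg ())]
    exact H2 g m n _ _ (hg ()) q m0 m1 hm r w0 w1 hw
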